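/- Consider a non-stationary K-armed bandit satisfying Assumption A2 with constants θ, ξ, η, run with the UCB-ERM algorithm with parameter α, where 1/2 ≤ η < 1 and ξ > 1 is large enough that there exists α > 2 with ξη(1−η) ≤ α < ξ(1−η). Let ρ̂_n^stream = (1/β) ln((1/n) Σ_{i=1}^K Σ_{t=1}^{T_i(n)} exp(β x_{i,t})) = (1/β) ln((1/n) Σ_{i=1}^K T_i(n) exp(β ρ̂_{i,T_i(n)})) be the empirical ERM_β of the stream of costs obtained by the algorithm. Then, setting η'' = α/(ξ(1−η)) and ξ'' = α − 1, there exists a constant θ'' > 1 (depending on R, K, Δ_min, β, θ, ξ, α, η) such that for every n ∈ ℕ and every z ≥ 1: P[n ρ̂_n^stream − n μ* ≥ n^{η''} z] ≤ θ''/z^{ξ''} and P[n ρ̂_n^stream − n μ* ≤ −n^{η''} z] ≤ θ''/z^{ξ''}; moreover |E[ρ̂_n^stream] − μ*| ≤ (1 + 2θ''/(α−2)) n^{α/(ξ(1−η)) − 1} for all n ≥ 1, so lim_{n→∞} E[ρ̂_n^stream] = μ*. -/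

import Mathlib

open MeasureTheory ProbabilityTheory Filter

/-- The empirical ERM_β estimator `ρ̂_n = (1/β) ln((1/n) Σ_{t<n} exp(β x_t))` (the sum runs
over the first `n` samples). -/
noncomputable def ermEst (β : ℝ) (n : ℕ) (x : ℕ → ℝ) : ℝ :=
  (1 / β) * Real.log ((1 / (n : ℝ)) * ∑ t ∈ Finset.range n, Real.exp (β * x t))

/-- The UCB exploration bonus `b_{t,s} = θ^{1/ξ} t^{α/ξ} / s^{1−η}`. -/
noncomputable def bonus (θ ξ η α : ℝ) (t s : ℕ) : ℝ :=
  θ ^ (1 / ξ) * (t : ℝ) ^ (α / ξ) / (s : ℝ) ^ (1 - η)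

/-- `pulls a i t ω` : the number of pulls `T_i(t)` of arm `i` up to and including round `t`
(rounds are indexed `1, 2, …`). -/
def pulls {Ω : Type*} {K : ℕ} (a : ℕ → Ω → Fin K) (i : Fin K) (t : ℕ) (ω : Ω) : ℕ :=
  ((Finset.Icc 1 t).filter fun s => a s ω = i).card

section Pulls

variable {Ω : Type*} {K : ℕ}

lemma pulls_zero (a : ℕ → Ω → Fin K) (i : Fin K) (ω : Ω) : pulls a i 0 ω = 0 := by
  simp [pulls]

lemma pulls_succ (a : ℕ → Ω → Fin K) (i : Fin K) (t : ℕ) (ω : Ω) :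
    pulls a i (t + 1) ω = pulls a i t ω + if a (t + 1) ω = i then 1 else 0 := by
  unfold pulls
  rw [← Finset.insert_Icc_right_eq_Icc_add_one (by omega : 1 ≤ t + 1), Finset.filter_insert]
  split_ifs with h
  · rw [Finset.card_insert_of_notMem (by simp)]
  · simp

lemma sum_pulls (a : ℕ → Ω → Fin K) (t : ℕ) (ω : Ω) : ∑ i, pulls a i t ω = t := by
  induction t with
  | zero => simp [pulls_zero]
  | succ t ih => simp [pulls_succ, Finset.sum_add_distrib, ih]

lemma pulls_le (a : ℕ → Ω → Fin K) (i : Fin K) (t : ℕ) (ω : Ω) : pulls a i t ω ≤ t := by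
  calc pulls a i t ω ≤ ∑ j, pulls a j t ω :=
        Finset.single_le_sum (f := fun j => pulls a j t ω) (fun _ _ => Nat.zero_le _)
          (Finset.mem_univ i)
    _ = t := sum_pulls a t ω

lemma pulls_add_pulls_le (a : ℕ → Ω → Fin K) {i j : Fin K} (hij : i ≠ j) (t : ℕ) (ω : Ω) :
    pulls a i t ω + pulls a j t ω ≤ t := by
  calc pulls a i t ω + pulls a j t ω = ∑ k ∈ {i, j}, pulls a k t ω :=
        (Finset.sum_pair (f := fun k => pulls a k t ω) hij).symm
    _ ≤ ∑ k, pulls a k t ω := Finset.sum_le_sum_of_subset (Finset.subset_univ _)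
    _ = t := sum_pulls a t ω

lemma exists_pull_time (a : ℕ → Ω → Fin K) (i : Fin K) (u n : ℕ) (ω : Ω)
    (h : u < pulls a i n ω) : ∃ t, 1 ≤ t ∧ t ≤ n ∧ a t ω = i ∧ pulls a i (t - 1) ω = u := by
  induction n with
  | zero => simp [pulls_zero] at h
  | succ n ih =>
    by_cases h' : u < pulls a i n ω
    · obtain ⟨t, h1, h2, h3, h4⟩ := ih h'
      exact ⟨t, h1, by omega, h3, h4⟩
    · rw [pulls_succ] at h
      split_ifs at h with ha
      · exact ⟨n + 1, by omega, le_rfl, ha, by simp; omega⟩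
      · omega

lemma exists_of_pulls_pos (a : ℕ → Ω → Fin K) (i : Fin K) (t : ℕ) (ω : Ω)
    (h : 1 ≤ pulls a i t ω) : ∃ s, 1 ≤ s ∧ s ≤ t ∧ a s ω = i := by
  obtain ⟨s, h1, h2, h3, -⟩ := exists_pull_time a i 0 t ω h
  exact ⟨s, h1, h2, h3⟩

lemma pulls_pos (a : ℕ → Ω → Fin K) (i : Fin K) (s t : ℕ) (ω : Ω)
    (h1 : 1 ≤ s) (h2 : s ≤ t) (h : a s ω = i) : 1 ≤ pulls a i t ω :=
  Finset.card_pos.2 ⟨s, by simp [h1, h2, h]⟩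

lemma measurable_pulls [MeasurableSpace Ω] {a : ℕ → Ω → Fin K} (ha : ∀ t, Measurable (a t))
    (i : Fin K) (t : ℕ) : Measurable (pulls a i t) := by
  induction t with
  | zero => simp [funext (pulls_zero a i)]
  | succ t ih =>
    rw [funext (pulls_succ a i t)]
    exact ih.add (Measurable.ite (ha _ (measurableSet_singleton i)) measurable_const
      measurable_const)

lemma measurable_sum_range_pulls [MeasurableSpace Ω] {a : ℕ → Ω → Fin K}
    (ha : ∀ t, Measurable (a t)) (i : Fin K) (n : ℕ) {f : ℕ → Ω → ℝ}
    (hf : ∀ t, Measurable (f t)) :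
    Measurable fun ω => ∑ t ∈ Finset.range (pulls a i n ω), f t ω := by
  have h : Measurable fun p : ℕ × Ω => ∑ t ∈ Finset.range p.1, f t p.2 :=
    measurable_from_prod_countable_right fun m =>
      Finset.measurable_sum (Finset.range m) fun t _ => hf t
  exact h.comp ((measurable_pulls ha i n).prodMk measurable_id)

/-- The sum of all the pulled samples differs from the sum of the first `n` samples of arm `j`
by at most the number of pulls of the other arms. -/
lemma abs_sum_pulls_sub_le (a : ℕ → Ω → Fin K) (j : Fin K) (n : ℕ) (ω : Ω)
    (f : Fin K → ℕ → ℝ) (C : ℝ) (hf0 : ∀ i t, 0 ≤ f i t) (hfC : ∀ i t, f i t ≤ C) :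
    |(∑ i, ∑ t ∈ Finset.range (pulls a i n ω), f i t) - ∑ t ∈ Finset.range n, f j t|
      ≤ C * ∑ i ∈ Finset.univ.erase j, (pulls a i n ω : ℝ) := by
  have hsum : (pulls a j n ω : ℝ) + ∑ i ∈ Finset.univ.erase j, (pulls a i n ω : ℝ) = n := by
    rw [Finset.add_sum_erase _ (fun i => (pulls a i n ω : ℝ)) (Finset.mem_univ j)]
    exact_mod_cast sum_pulls a n ω
  rw [← Finset.add_sum_erase _ _ (Finset.mem_univ j),
    ← Finset.sum_range_add_sum_Ico (f j) (pulls_le a j n ω)]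
  have h1 : 0 ≤ ∑ i ∈ Finset.univ.erase j, ∑ t ∈ Finset.range (pulls a i n ω), f i t :=
    Finset.sum_nonneg fun i _ => Finset.sum_nonneg fun t _ => hf0 i t
  have h2 : ∑ i ∈ Finset.univ.erase j, ∑ t ∈ Finset.range (pulls a i n ω), f i t
      ≤ C * ∑ i ∈ Finset.univ.erase j, (pulls a i n ω : ℝ) := by
    rw [Finset.mul_sum]
    refine Finset.sum_le_sum fun i _ => ?_
    calc _ ≤ ∑ t ∈ Finset.range (pulls a i n ω), C := Finset.sum_le_sum fun t _ => hfC i t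
      _ = _ := by simp [mul_comm]
  have h3 : 0 ≤ ∑ t ∈ Finset.Ico (pulls a j n ω) n, f j t :=
    Finset.sum_nonneg fun t _ => hf0 j t
  have h4 : ∑ t ∈ Finset.Ico (pulls a j n ω) n, f j t
      ≤ C * ∑ i ∈ Finset.univ.erase j, (pulls a i n ω : ℝ) := by
    calc _ ≤ ∑ t ∈ Finset.Ico (pulls a j n ω) n, C := Finset.sum_le_sum fun t _ => hfC j t
      _ = (n - pulls a j n ω : ℝ) * C := by
        simp [Nat.cast_sub (pulls_le a j n ω)]
      _ = _ := by rw [← hsum]; ring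
  rw [abs_le]
  constructor <;> linarith

end Pulls

lemma abs_log_sub_log_le {c x y : ℝ} (hc : 0 < c) (hx : c ≤ x) (hy : c ≤ y) :
    |Real.log x - Real.log y| ≤ |x - y| / c := by
  have key : ∀ {x y : ℝ}, c ≤ x → c ≤ y → Real.log x - Real.log y ≤ |x - y| / c := by
    intro x y hx hy
    have hx0 : 0 < x := hc.trans_le hx
    have hy0 : 0 < y := hc.trans_le hy
    rw [← Real.log_div hx0.ne' hy0.ne']
    calc Real.log (x / y) ≤ x / y - 1 := Real.log_le_sub_one_of_pos (by positivity)
      _ = (x - y) / y := by field_simp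
      _ ≤ |x - y| / y := by gcongr; exact le_abs_self _
      _ ≤ |x - y| / c := by gcongr
  rw [abs_le]
  have h1 := key hx hy
  have h2 := key hy hx
  rw [abs_sub_comm] at h2
  constructor <;> linarith

/-- The empirical ERM of the stream is close to that of the first `n` samples of arm `j`. -/
lemma abs_stream_sub_ermEst_le {Ω : Type*} {K : ℕ} (a : ℕ → Ω → Fin K) (j : Fin K) {n : ℕ}
    (hn : 1 ≤ n) (ω : Ω) {R β : ℝ} (hβ : 0 < β) (x : Fin K → ℕ → ℝ)
    (hx : ∀ i t, x i t ∈ Set.Icc (-R) R) :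
    |(n : ℝ) * ((1 / β) * Real.log ((1 / (n : ℝ)) * ∑ i,
        ∑ t ∈ Finset.range (pulls a i n ω), Real.exp (β * x i t))) - n * ermEst β n (x j)|
      ≤ Real.exp (β * R) / (β * Real.exp (β * -R)) *
        ∑ i ∈ Finset.univ.erase j, (pulls a i n ω : ℝ) := by
  have hn0 : (0 : ℝ) < n := by exact_mod_cast hn
  have hlow : ∀ i t, Real.exp (β * -R) ≤ Real.exp (β * x i t) := fun i t =>
    Real.exp_le_exp.2 (mul_le_mul_of_nonneg_left (hx i t).1 hβ.le)
  have hup : ∀ i t, Real.exp (β * x i t) ≤ Real.exp (β * R) := fun i t =>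
    Real.exp_le_exp.2 (mul_le_mul_of_nonneg_left (hx i t).2 hβ.le)
  have hdiff := abs_sum_pulls_sub_le a j n ω (fun i t => Real.exp (β * x i t)) _
    (fun i t => (Real.exp_pos _).le) hup
  set S := ∑ i, ∑ t ∈ Finset.range (pulls a i n ω), Real.exp (β * x i t) with hS
  set S' := ∑ t ∈ Finset.range n, Real.exp (β * x j t) with hS'
  set W := ∑ i ∈ Finset.univ.erase j, (pulls a i n ω : ℝ)
  set c := Real.exp (β * -R)
  have hc : 0 < c := Real.exp_pos _
  have h1 : c ≤ 1 / (n : ℝ) * S := by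
    have : n * c ≤ S := by
      calc n * c = ∑ i, ∑ t ∈ Finset.range (pulls a i n ω), c := by
            simp only [Finset.sum_const, Finset.card_range, nsmul_eq_mul, ← Finset.sum_mul]
            congr 1
            exact_mod_cast (sum_pulls a n ω).symm
        _ ≤ S := Finset.sum_le_sum fun i _ => Finset.sum_le_sum fun t _ => hlow i t
    rw [one_div, inv_mul_eq_div, le_div_iff₀ hn0]
    linarith
  have h2 : c ≤ 1 / (n : ℝ) * S' := by
    have : n * c ≤ S' := by
      calc n * c = ∑ t ∈ Finset.range n, c := by simp
        _ ≤ S' := Finset.sum_le_sum fun t _ => hlow j t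
    rw [one_div, inv_mul_eq_div, le_div_iff₀ hn0]
    linarith
  have h3 := abs_log_sub_log_le hc h1 h2
  have h4 : |1 / (n : ℝ) * S - 1 / n * S'| = |S - S'| / n := by
    rw [← mul_sub, abs_mul, abs_of_pos (by positivity)]
    ring
  rw [h4] at h3
  unfold ermEst
  rw [← mul_sub, ← mul_sub, abs_mul, abs_mul, abs_of_pos hn0,
    abs_of_pos (by positivity : 0 < 1 / β)]
  calc _ ≤ n * (1 / β * (|S - S'| / n / c)) := by gcongr
    _ = |S - S'| / (β * c) := by field_simp
    _ ≤ Real.exp (β * R) * W / (β * c) := by gcongr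
    _ = _ := by ring

lemma sum_Icc_add_rpow_neg_le {α : ℝ} (hα : 2 < α) {u : ℕ} (hu : 1 ≤ u) (n : ℕ) :
    ∑ s ∈ Finset.Icc 1 n, ((u + s : ℕ) : ℝ) ^ (-α) ≤ (u : ℝ) ^ (1 - α) := by
  have hu0 : (0 : ℝ) < u := by exact_mod_cast hu
  have h1 : ∀ s ∈ Finset.Icc 1 n,
      ((u + s : ℕ) : ℝ) ^ (-α) ≤ (u : ℝ) ^ (2 - α) * (((u + s : ℕ) : ℝ) ^ 2)⁻¹ := by
    intro s _
    have hus : (0 : ℝ) < ((u + s : ℕ) : ℝ) := by push_cast; positivity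
    have : ((u + s : ℕ) : ℝ) ^ (-α) = ((u + s : ℕ) : ℝ) ^ (2 - α) * (((u + s : ℕ) : ℝ) ^ 2)⁻¹ := by
      rw [← Real.rpow_natCast _ 2, ← Real.rpow_neg hus.le, ← Real.rpow_add hus]
      congr 1
      push_cast
      ring
    rw [this]
    gcongr ?_ * _
    exact Real.rpow_le_rpow_of_nonpos hu0 (by push_cast; linarith [Nat.cast_nonneg (α := ℝ) s])
      (by linarith)
  have h2 : ∑ s ∈ Finset.Icc 1 n, (((u + s : ℕ) : ℝ) ^ 2)⁻¹ ≤ (u : ℝ)⁻¹ - ((u + n : ℕ) : ℝ)⁻¹ := by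
    induction n with
    | zero => simp
    | succ n ih =>
      rw [Finset.sum_Icc_succ_top (by omega)]
      have h3 := ih (fun s hs => h1 s (Finset.Icc_subset_Icc_right (by omega) hs))
      have h4 : (((u + (n + 1) : ℕ) : ℝ) ^ 2)⁻¹
          ≤ ((u + n : ℕ) : ℝ)⁻¹ - ((u + (n + 1) : ℕ) : ℝ)⁻¹ := by
        push_cast
        have hm : (0 : ℝ) < u + n := by positivity
        rw [inv_sub_inv (by positivity) (by positivity), inv_eq_one_div,
          div_le_div_iff₀ (by positivity) (by positivity)]
        nlinarith
      linarith
  calc _ ≤ ∑ s ∈ Finset.Icc 1 n, (u : ℝ) ^ (2 - α) * (((u + s : ℕ) : ℝ) ^ 2)⁻¹ :=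
        Finset.sum_le_sum h1
    _ = (u : ℝ) ^ (2 - α) * ∑ s ∈ Finset.Icc 1 n, (((u + s : ℕ) : ℝ) ^ 2)⁻¹ := by
        rw [Finset.mul_sum]
    _ ≤ (u : ℝ) ^ (2 - α) * (u : ℝ)⁻¹ := by
        gcongr
        exact h2.trans (sub_le_self _ (by positivity))
    _ = (u : ℝ) ^ (1 - α) := by
        rw [← Real.rpow_neg_one, ← Real.rpow_add hu0]
        congr 1
        ring

lemma mul_bonus_eq {s : ℕ} (hs : 1 ≤ s) (θ ξ η α : ℝ) (t : ℕ) :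
    (s : ℝ) * bonus θ ξ η α t s = (s : ℝ) ^ η * (θ ^ (1 / ξ) * (t : ℝ) ^ (α / ξ)) := by
  have hs0 : (0 : ℝ) < s := by exact_mod_cast hs
  have : (s : ℝ) ^ (1 - η) * (s : ℝ) ^ η = s := by
    rw [← Real.rpow_add hs0]; simp
  have h0 : (s : ℝ) ^ (1 - η) ≠ 0 := (Real.rpow_pos_of_pos hs0 _).ne'
  unfold bonus
  rw [mul_div_assoc', div_eq_iff h0]
  calc _ = (s : ℝ) ^ (1 - η) * (s : ℝ) ^ η * (θ ^ (1 / ξ) * (t : ℝ) ^ (α / ξ)) := by rw [this]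
    _ = _ := by ring

lemma bonus_mono {θ ξ α : ℝ} (hθ : 0 < θ) (hξ : 0 < ξ) (hα : 0 < α) (η : ℝ) (s : ℕ)
    {t t' : ℕ} (h : t ≤ t') : bonus θ ξ η α t s ≤ bonus θ ξ η α t' s := by
  unfold bonus
  gcongr

lemma one_le_level {θ ξ α : ℝ} (hθ : 1 < θ) (hξ : 0 < ξ) (hα : 0 < α) {t : ℕ} (ht : 1 ≤ t) :
    1 ≤ θ ^ (1 / ξ) * (t : ℝ) ^ (α / ξ) :=
  one_le_mul_of_one_le_of_one_le (Real.one_le_rpow hθ.le (by positivity))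
    (Real.one_le_rpow (by exact_mod_cast ht) (by positivity))

lemma div_level_rpow {θ ξ α : ℝ} (hθ : 1 < θ) (hξ : 0 < ξ) (t : ℕ) :
    θ / (θ ^ (1 / ξ) * (t : ℝ) ^ (α / ξ)) ^ ξ = (t : ℝ) ^ (-α) := by
  have hθ0 : 0 < θ := by linarith
  rw [Real.mul_rpow (by positivity) (by positivity), ← Real.rpow_mul hθ0.le,
    ← Real.rpow_mul (by positivity), div_mul_cancel₀ _ hξ.ne', div_mul_cancel₀ _ hξ.ne',
    Real.rpow_one, Real.rpow_neg (by positivity), div_mul_eq_div_div, div_self hθ0.ne', one_div]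

/-- Tail bound for the number of pulls of a suboptimal arm. -/
lemma measure_lt_pulls_le {Ω : Type*} [MeasurableSpace Ω] (P : Measure Ω) {K : ℕ}
    {θ ξ η α : ℝ} (hθ : 1 < θ) (hξ : 1 < ξ) (hα2 : 2 < α)
    (r : Fin K → ℕ → Ω → ℝ) (μ : Fin K → ℝ) {i j : Fin K} (hij : i ≠ j)
    (hconcU : ∀ n : ℕ, 1 ≤ n → ∀ z : ℝ, 1 ≤ z →
      P {ω | (n : ℝ) ^ η * z ≤ (n : ℝ) * r j n ω - (n : ℝ) * μ j} ≤ ENNReal.ofReal (θ / z ^ ξ))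
    (hconcL : ∀ n : ℕ, 1 ≤ n → ∀ z : ℝ, 1 ≤ z →
      P {ω | (n : ℝ) * r i n ω - (n : ℝ) * μ i ≤ -((n : ℝ) ^ η * z)}
        ≤ ENNReal.ofReal (θ / z ^ ξ))
    (a : ℕ → Ω → Fin K)
    (hinit : ∀ ω, ∀ t, 1 ≤ t → t ≤ K → ((a t ω : ℕ) = t - 1))
    (hsel : ∀ ω, ∀ t, K < t → ∀ i : Fin K,
      r (a t ω) (pulls a (a t ω) (t - 1) ω) ω
          - bonus θ ξ η α t (pulls a (a t ω) (t - 1) ω)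
        ≤ r i (pulls a i (t - 1) ω) ω - bonus θ ξ η α t (pulls a i (t - 1) ω))
    {n u : ℕ} (hu : 1 ≤ u) (hbonus : 2 * bonus θ ξ η α n u ≤ μ i - μ j) :
    P {ω | u < pulls a i n ω} ≤ ENNReal.ofReal (2 * (u : ℝ) ^ (1 - α)) := by
  have hu0 : (0 : ℝ) < u := by exact_mod_cast hu
  have hu1 : (1 : ℝ) ≤ u := by exact_mod_cast hu
  have hθ0 : 0 < θ := by linarith
  have hξ0 : 0 < ξ := by linarith
  have hα0 : 0 < α := by linarith
  rcases le_or_gt n u with hnu | hun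
  · have : {ω | u < pulls a i n ω} = ∅ := by
      ext ω
      simpa using (pulls_le a i n ω).trans hnu
    simp [this]
  have hn : 1 ≤ n := by omega
  have hsub : {ω | u < pulls a i n ω} ⊆
      {ω | (u : ℝ) * r i u ω - u * μ i ≤ -((u : ℝ) ^ η * (θ ^ (1 / ξ) * (n : ℝ) ^ (α / ξ)))} ∪
      ⋃ s ∈ Finset.Icc 1 n, {ω | (s : ℝ) ^ η * (θ ^ (1 / ξ) * ((u + s : ℕ) : ℝ) ^ (α / ξ))
        ≤ s * r j s ω - s * μ j} := by
    intro ω hω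
    obtain ⟨t, ht1, htn, hat, hpt⟩ := exists_pull_time a i u n ω hω
    have htK : K < t := by
      by_contra! htK
      obtain ⟨s, hs1, hst, has⟩ := exists_of_pulls_pos a i (t - 1) ω (by omega)
      have e1 := hinit ω t ht1 htK
      have e2 := hinit ω s hs1 (by omega)
      rw [hat] at e1
      rw [has] at e2
      omega
    have hjpos : 1 ≤ pulls a j (t - 1) ω := by
      have hjK := j.2
      refine pulls_pos a j (j + 1) (t - 1) ω (by omega) (by omega) (Fin.ext ?_)
      rw [hinit ω (j + 1) (by omega) (by omega)]
      omega
    have hadd := pulls_add_pulls_le a hij (t - 1) ω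
    have hS := hsel ω t htK j
    rw [hat, hpt] at hS
    rw [hpt] at hadd
    set s := pulls a j (t - 1) ω
    have hs0 : (0 : ℝ) < s := by exact_mod_cast hjpos
    have hb1 := bonus_mono hθ0 hξ0 hα0 η u htn
    have hb2 := bonus_mono hθ0 hξ0 hα0 η s (by omega : u + s ≤ t)
    rcases le_or_gt (r i u ω - bonus θ ξ η α t u) (μ j) with h | h
    · left
      simp only [Set.mem_ofPred_eq]
      rw [← mul_bonus_eq hu]
      have : r i u ω - μ i ≤ - bonus θ ξ η α n u := by linarith
      nlinarith
    · right
      simp only [Set.mem_iUnion, Set.mem_ofPred_eq]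
      refine ⟨s, Finset.mem_Icc.2 ⟨hjpos, by omega⟩, ?_⟩
      rw [← mul_bonus_eq hjpos]
      have : bonus θ ξ η α (u + s) s ≤ r j s ω - μ j := by linarith
      nlinarith
  calc P {ω | u < pulls a i n ω} ≤ _ := measure_mono hsub
    _ ≤ _ := measure_union_le _ _
    _ ≤ ENNReal.ofReal ((n : ℝ) ^ (-α)) +
        ∑ s ∈ Finset.Icc 1 n, ENNReal.ofReal (((u + s : ℕ) : ℝ) ^ (-α)) := by
      gcongr
      · refine (hconcL u hu _ (one_le_level hθ hξ0 hα0 hn)).trans_eq ?_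
        rw [div_level_rpow hθ hξ0]
      · refine (measure_biUnion_finset_le _ _).trans (Finset.sum_le_sum fun s hs => ?_)
        have hs1 := (Finset.mem_Icc.1 hs).1
        refine (hconcU s hs1 _ (one_le_level hθ hξ0 hα0 (by omega))).trans_eq ?_
        rw [div_level_rpow hθ hξ0]
    _ = ENNReal.ofReal ((n : ℝ) ^ (-α) + ∑ s ∈ Finset.Icc 1 n, ((u + s : ℕ) : ℝ) ^ (-α)) := by
      rw [← ENNReal.ofReal_sum_of_nonneg fun s _ => by positivity,
        ← ENNReal.ofReal_add (by positivity) (Finset.sum_nonneg fun s _ => by positivity)]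
    _ ≤ _ := by
      apply ENNReal.ofReal_le_ofReal
      have h1 := sum_Icc_add_rpow_neg_le hα2 hu n
      have h2 : (n : ℝ) ^ (-α) ≤ (u : ℝ) ^ (1 - α) :=
        calc (n : ℝ) ^ (-α) ≤ (u : ℝ) ^ (-α) :=
              Real.rpow_le_rpow_of_nonpos hu0 (by exact_mod_cast hun.le) (by linarith)
          _ ≤ (u : ℝ) ^ (1 - α) := Real.rpow_le_rpow_of_exponent_le hu1 (by linarith)
      linarith

lemma two_mul_bonus_le {θ ξ η α Δ : ℝ} (hθ : 1 < θ) (hξ : 1 < ξ) (hη1 : η < 1)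
    (hΔ : 0 < Δ) {n u : ℕ} (hu : 1 ≤ u)
    (h : (2 * θ ^ (1 / ξ) / Δ) ^ (1 / (1 - η)) * (n : ℝ) ^ (α / (ξ * (1 - η))) ≤ u) :
    2 * bonus θ ξ η α n u ≤ Δ := by
  have hη : 0 < 1 - η := by linarith
  have hu0 : (0 : ℝ) < u := by exact_mod_cast hu
  have hθ0 : 0 < θ := by linarith
  have h' := Real.rpow_le_rpow (by positivity) h hη.le
  rw [Real.mul_rpow (by positivity) (by positivity), ← Real.rpow_mul (by positivity),
    ← Real.rpow_mul (by positivity), div_mul_cancel₀ _ hη.ne', Real.rpow_one,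
    show α / (ξ * (1 - η)) * (1 - η) = α / ξ by field_simp] at h'
  unfold bonus
  rw [mul_div_assoc', div_le_iff₀ (by positivity)]
  rw [div_mul_eq_mul_div, div_le_iff₀ hΔ] at h'
  linarith

/-- A polynomial tail of order greater than one bounds the expectation. -/
lemma integral_abs_le_of_tail {Ω : Type*} [MeasurableSpace Ω] (P : Measure Ω)
    [IsProbabilityMeasure P] {f : Ω → ℝ} (hf : Measurable f) {C p : ℝ} (hC : 0 ≤ C) (hp : 1 < p)
    (htail : ∀ z : ℝ, 1 ≤ z → P {ω | z ≤ |f ω|} ≤ ENNReal.ofReal (C / z ^ p)) :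
    Integrable f P ∧ ∫ ω, |f ω| ∂P ≤ 1 + C / (p - 1) := by
  have hp1 : 0 < p - 1 := by linarith
  have hint : ∫ z in Set.Ioi (1 : ℝ), C * z ^ (-p) = C / (p - 1) := by
    rw [integral_const_mul, integral_Ioi_rpow_of_lt (by linarith) one_pos, Real.one_rpow,
      show -p + 1 = -(p - 1) by ring, neg_div_neg_eq, mul_one_div]
  have hlayer : ∫⁻ ω, ENNReal.ofReal |f ω| ∂P ≤ ENNReal.ofReal (1 + C / (p - 1)) := by
    rw [lintegral_eq_lintegral_meas_le P (Eventually.of_forall fun ω => abs_nonneg _)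
      hf.abs.aemeasurable, ← Set.Ioc_union_Ioi_eq_Ioi (zero_le_one' ℝ),
      lintegral_union measurableSet_Ioi (Set.Ioc_disjoint_Ioi le_rfl),
      ENNReal.ofReal_add zero_le_one (by positivity)]
    gcongr
    · calc _ ≤ ∫⁻ _ in Set.Ioc (0 : ℝ) 1, 1 := lintegral_mono fun z => prob_le_one
        _ = ENNReal.ofReal 1 := by simp
    · rw [← hint, ofReal_integral_eq_lintegral_ofReal
        ((integrableOn_Ioi_rpow_of_lt (by linarith) one_pos).const_mul C)]
      · refine setLIntegral_mono' measurableSet_Ioi fun z hz => ?_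
        have hz : (1 : ℝ) < z := hz
        rw [Real.rpow_neg (by linarith), ← div_eq_mul_inv]
        exact htail z hz.le
      · filter_upwards [ae_restrict_mem measurableSet_Ioi] with z hz
        have hz : (1 : ℝ) < z := hz
        positivity
  refine ⟨⟨hf.aestronglyMeasurable, ?_⟩, ?_⟩
  · rw [hasFiniteIntegral_iff_norm]
    exact hlayer.trans_lt ENNReal.ofReal_lt_top
  · rw [integral_eq_lintegral_of_nonneg_ae (Eventually.of_forall fun ω => abs_nonneg _)
      hf.abs.aestronglyMeasurable]
    exact ENNReal.toReal_le_of_le_ofReal (by positivity) hlayer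

lemma abs_integral_sub_le_of_tail {Ω : Type*} [MeasurableSpace Ω] (P : Measure Ω)
    [IsProbabilityMeasure P] {Y : Ω → ℝ} (hY : Measurable Y) {m e C p : ℝ} {n : ℕ} (hn : 1 ≤ n)
    (hC : 0 ≤ C) (hp : 1 < p)
    (htail : ∀ z : ℝ, 1 ≤ z →
      P {ω | (n : ℝ) ^ e * z ≤ |(n : ℝ) * Y ω - n * m|} ≤ ENNReal.ofReal (C / z ^ p)) :
    |∫ ω, Y ω ∂P - m| ≤ (1 + C / (p - 1)) * (n : ℝ) ^ (e - 1) := by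
  have hn0 : (0 : ℝ) < n := by exact_mod_cast hn
  have hne : (0 : ℝ) < (n : ℝ) ^ e := Real.rpow_pos_of_pos hn0 _
  have hfm : Measurable fun ω => ((n : ℝ) * Y ω - n * m) / (n : ℝ) ^ e :=
    ((hY.const_mul _).sub_const _).div_const _
  obtain ⟨hint, hle⟩ := integral_abs_le_of_tail P hfm hC hp fun z hz => by
    refine (measure_mono fun ω hω => ?_).trans (htail z hz)
    simp only [Set.mem_ofPred_eq, abs_div, abs_of_pos hne, le_div_iff₀ hne] at hω ⊢
    linarith
  have hYf : ∀ ω, Y ω = m + (n : ℝ) ^ (e - 1) * (((n : ℝ) * Y ω - n * m) / (n : ℝ) ^ e) := by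
    intro ω
    rw [Real.rpow_sub hn0, Real.rpow_one]
    field_simp
    ring
  have hI : ∫ ω, Y ω ∂P - m
      = (n : ℝ) ^ (e - 1) * ∫ ω, ((n : ℝ) * Y ω - n * m) / (n : ℝ) ^ e ∂P := by
    rw [integral_congr_ae (Eventually.of_forall hYf),
      integral_add (integrable_const _) (hint.const_mul _), integral_const_mul]
    simp
  rw [hI, abs_mul, abs_of_pos (by positivity), mul_comm]
  gcongr
  exact abs_integral_le_integral_abs.trans hle

/-- Polynomial tail bound for the number of pulls of a suboptimal arm, at scale `n ^ e`. -/
lemma measure_scaled_le_pulls_le {Ω : Type*} [MeasurableSpace Ω] (P : Measure Ω) {K : ℕ}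
    (a : ℕ → Ω → Fin K) (i : Fin K) {n : ℕ} (hn : 1 ≤ n) {e α D M z : ℝ} (he : 0 ≤ e)
    (hα : 2 < α) (hD : 0 ≤ D) (hM : 0 < M) (hz : M * (1 + D) ≤ z)
    (hpull : ∀ u : ℕ, 1 ≤ u → D * (n : ℝ) ^ e ≤ u →
      P {ω | u < pulls a i n ω} ≤ ENNReal.ofReal (2 * (u : ℝ) ^ (1 - α))) :
    P {ω | 4 * ((n : ℝ) ^ e * z / M) ≤ pulls a i n ω}
      ≤ ENNReal.ofReal (2 * M ^ (α - 1) / z ^ (α - 1)) := by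
  have hne : (1 : ℝ) ≤ (n : ℝ) ^ e := Real.one_le_rpow (by exact_mod_cast hn) he
  have hz0 : 0 < z := lt_of_lt_of_le (by positivity) hz
  have hzM : 1 + D ≤ z / M := by rw [le_div_iff₀ hM]; linarith
  set w := (n : ℝ) ^ e * z / M with hw
  have hw1 : (n : ℝ) ^ e * (1 + D) ≤ w := by
    rw [hw, mul_div_assoc]
    gcongr
  have hwz : z / M ≤ w := by
    rw [hw, mul_div_assoc]
    exact le_mul_of_one_le_left (by positivity) hne
  have hw2 : 1 ≤ w := by linarith
  have hu1 : (⌊2 * w⌋₊ : ℝ) ≤ 2 * w := Nat.floor_le (by linarith)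
  have hu2 : w ≤ (⌊2 * w⌋₊ : ℝ) := by
    have := Nat.lt_floor_add_one (2 * w)
    linarith
  have hu3 : 1 ≤ ⌊2 * w⌋₊ := Nat.le_floor (by push_cast; linarith)
  calc _ ≤ P {ω | ⌊2 * w⌋₊ < pulls a i n ω} := by
        refine measure_mono fun ω hω => ?_
        simp only [Set.mem_ofPred_eq] at hω ⊢
        have : (⌊2 * w⌋₊ : ℝ) < pulls a i n ω := by linarith
        exact_mod_cast this
    _ ≤ _ := hpull _ hu3 (by nlinarith)
    _ ≤ _ := by
        apply ENNReal.ofReal_le_ofReal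
        have h : M ^ (α - 1) / z ^ (α - 1) = (z / M) ^ (1 - α) := by
          rw [← neg_sub α 1, Real.rpow_neg (by positivity), Real.div_rpow hz0.le hM.le, inv_div]
        rw [mul_div_assoc, h]
        gcongr ?_ * ?_
        exact Real.rpow_le_rpow_of_nonpos (by positivity) (hwz.trans hu2) (by linarith)

/-- concentration and convergence of the empirical ERM_β of the *stream*
of costs `ρ̂_n^stream = (1/β) ln((1/n) Σ_i Σ_{t≤T_i(n)} exp(β x_{i,t}))` obtained by the
UCB-ERM algorithm on a non-stationary `K`-armed bandit satisfying Assumption A2: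
polynomial concentration at exponents `η'' = α/(ξ(1−η))`, `ξ'' = α − 1` for some
`θ'' > 1`, the rate `|E[ρ̂_n^stream] − μ*| ≤ (1 + 2θ''/(α−2)) n^{α/(ξ(1−η))−1}`, and
`lim E[ρ̂_n^stream] = μ*`. -/
theorem stmt11 {Ω : Type*} [MeasurableSpace Ω] (P : Measure Ω) [IsProbabilityMeasure P]
    (K : ℕ) (hK : 1 ≤ K) (R β : ℝ) (hR : 0 < R) (hβ : 0 < β)
    (x : Fin K → ℕ → Ω → ℝ) (hxmeas : ∀ i t, Measurable (x i t))
    (hxbdd : ∀ i t ω, x i t ω ∈ Set.Icc (-R) R)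
    (θ ξ η α : ℝ) (hθ : 1 < θ) (hξ : 1 < ξ) (hη : 1 / 2 ≤ η) (hη1 : η < 1)
    (hα2 : 2 < α) (hαl : ξ * η * (1 - η) ≤ α) (hαu : α < ξ * (1 - η))
    (μ : Fin K → ℝ)
    (hconv : ∀ i, Tendsto (fun n => ∫ ω, ermEst β n (fun t => x i t ω) ∂P) atTop
      (nhds (μ i)))
    (hconcU : ∀ i, ∀ n : ℕ, 1 ≤ n → ∀ z : ℝ, 1 ≤ z →
      P {ω | (n : ℝ) ^ η * z ≤ (n : ℝ) * ermEst β n (fun t => x i t ω) - (n : ℝ) * μ i}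
        ≤ ENNReal.ofReal (θ / z ^ ξ))
    (hconcL : ∀ i, ∀ n : ℕ, 1 ≤ n → ∀ z : ℝ, 1 ≤ z →
      P {ω | (n : ℝ) * ermEst β n (fun t => x i t ω) - (n : ℝ) * μ i ≤ -((n : ℝ) ^ η * z)}
        ≤ ENNReal.ofReal (θ / z ^ ξ))
    (istar : Fin K) (hstar : ∀ i, i ≠ istar → μ istar < μ i)
    (Δmin : ℝ) (hΔ : IsLeast {d | ∃ i, i ≠ istar ∧ d = μ i - μ istar} Δmin)
    (a : ℕ → Ω → Fin K) (hameas : ∀ t, Measurable (a t))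
    (hinit : ∀ ω, ∀ t, 1 ≤ t → t ≤ K → ((a t ω : ℕ) = t - 1))
    (hsel : ∀ ω, ∀ t, K < t → ∀ i : Fin K,
      ermEst β (pulls a (a t ω) (t - 1) ω) (fun u => x (a t ω) u ω)
          - bonus θ ξ η α t (pulls a (a t ω) (t - 1) ω)
        ≤ ermEst β (pulls a i (t - 1) ω) (fun u => x i u ω)
          - bonus θ ξ η α t (pulls a i (t - 1) ω)) :
    ∃ θ'' : ℝ, 1 < θ'' ∧
      (∀ n : ℕ, 1 ≤ n → ∀ z : ℝ, 1 ≤ z →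
        P {ω | (n : ℝ) ^ (α / (ξ * (1 - η))) * z ≤
              (n : ℝ) * ((1 / β) * Real.log ((1 / (n : ℝ)) * ∑ i,
                  ∑ t ∈ Finset.range (pulls a i n ω), Real.exp (β * x i t ω)))
                - (n : ℝ) * μ istar}
          ≤ ENNReal.ofReal (θ'' / z ^ (α - 1)) ∧
        P {ω | (n : ℝ) * ((1 / β) * Real.log ((1 / (n : ℝ)) * ∑ i,
                  ∑ t ∈ Finset.range (pulls a i n ω), Real.exp (β * x i t ω)))
                - (n : ℝ) * μ istar ≤ -((n : ℝ) ^ (α / (ξ * (1 - η))) * z)}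
          ≤ ENNReal.ofReal (θ'' / z ^ (α - 1))) ∧
      (∀ n : ℕ, 1 ≤ n →
        |(∫ ω, (1 / β) * Real.log ((1 / (n : ℝ)) * ∑ i,
            ∑ t ∈ Finset.range (pulls a i n ω), Real.exp (β * x i t ω)) ∂P) - μ istar|
          ≤ (1 + 2 * θ'' / (α - 2)) * (n : ℝ) ^ (α / (ξ * (1 - η)) - 1)) ∧
      Tendsto (fun n : ℕ => ∫ ω, (1 / β) * Real.log ((1 / (n : ℝ)) * ∑ i,
          ∑ t ∈ Finset.range (pulls a i n ω), Real.exp (β * x i t ω)) ∂P) atTop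
        (nhds (μ istar)) := by
  have hη0 : 0 < 1 - η := by linarith
  have hξ0 : 0 < ξ := by linarith
  have he0 : 0 < α / (ξ * (1 - η)) := by positivity
  have he1 : α / (ξ * (1 - η)) < 1 := (div_lt_one (by positivity)).2 hαu
  have hηe : η ≤ α / (ξ * (1 - η)) := by
    rw [le_div_iff₀ (by positivity)]
    linarith
  have hαξ : α - 1 ≤ ξ := by nlinarith
  have hΔ0 : 0 < Δmin := by
    obtain ⟨i, hi, rfl⟩ := hΔ.1
    linarith [hstar i hi]
  have hK0 : (0 : ℝ) < K := by exact_mod_cast hK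
  have hY : ∀ n : ℕ, Measurable fun ω => (1 / β) * Real.log ((1 / (n : ℝ)) * ∑ i,
      ∑ t ∈ Finset.range (pulls a i n ω), Real.exp (β * x i t ω)) := fun n =>
    ((Real.measurable_log.comp ((Finset.measurable_sum _ fun i _ =>
      measurable_sum_range_pulls hameas i n fun t =>
        ((hxmeas i t).const_mul β).exp).const_mul _))).const_mul _
  set e := α / (ξ * (1 - η)) with he
  set Y : ℕ → Ω → ℝ := fun n ω => (1 / β) * Real.log ((1 / (n : ℝ)) * ∑ i,
    ∑ t ∈ Finset.range (pulls a i n ω), Real.exp (β * x i t ω)) with hYdef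
  set C := Real.exp (β * R) / (β * Real.exp (β * -R)) with hCdef
  have hC0 : 0 < C := by positivity
  set D := (2 * θ ^ (1 / ξ) / Δmin) ^ (1 / (1 - η)) with hDdef
  have hD0 : 0 ≤ D := by positivity
  set M := 8 * C * K with hMdef
  have hM0 : 0 < M := by positivity
  set z₀ := M * (1 + D) + 2 with hz₀
  have hz₀2 : 2 ≤ z₀ := by rw [hz₀]; linarith [show 0 ≤ M * (1 + D) by positivity]
  set θ' := z₀ ^ (α - 1) + (2 * θ * 2 ^ ξ + K * (2 * M ^ (α - 1))) with hθ'
  have hz₀1 : 1 < z₀ ^ (α - 1) := Real.one_lt_rpow (by linarith) (by linarith)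
  have hθ'1 : 1 < θ' := lt_of_lt_of_le hz₀1 (le_add_of_nonneg_right (by positivity))
  have htail : ∀ n : ℕ, 1 ≤ n → ∀ z : ℝ, 1 ≤ z →
      P {ω | (n : ℝ) ^ e * z ≤ |(n : ℝ) * Y n ω - n * μ istar|}
        ≤ ENNReal.ofReal (θ' / z ^ (α - 1)) := by
    intro n hn z hz
    have hn1 : (1 : ℝ) ≤ n := by exact_mod_cast hn
    have hzα : 0 < z ^ (α - 1) := Real.rpow_pos_of_pos (by linarith) _
    rcases le_or_gt z z₀ with hzz | hzz
    · refine prob_le_one.trans ?_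
      rw [ENNReal.one_le_ofReal, one_le_div hzα]
      calc z ^ (α - 1) ≤ z₀ ^ (α - 1) := Real.rpow_le_rpow (by linarith) hzz (by linarith)
        _ ≤ θ' := le_add_of_nonneg_right (by positivity)
    have hz2 : 1 ≤ z / 2 := by linarith
    have hne : (n : ℝ) ^ η ≤ (n : ℝ) ^ e := Real.rpow_le_rpow_of_exponent_le hn1 hηe
    have hne0 : 0 < (n : ℝ) ^ e := by positivity
    have hsub : {ω | (n : ℝ) ^ e * z ≤ |(n : ℝ) * Y n ω - n * μ istar|} ⊆
        ({ω | (n : ℝ) ^ η * (z / 2)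
            ≤ (n : ℝ) * ermEst β n (fun t => x istar t ω) - n * μ istar} ∪
          {ω | (n : ℝ) * ermEst β n (fun t => x istar t ω) - n * μ istar
            ≤ -((n : ℝ) ^ η * (z / 2))}) ∪
        ⋃ i ∈ Finset.univ.erase istar, {ω | 4 * ((n : ℝ) ^ e * z / M) ≤ pulls a i n ω} := by
      intro ω hω
      by_contra hcon
      simp only [Set.mem_union, Set.mem_iUnion, Set.mem_ofPred_eq, not_or, not_exists,
        not_le, Finset.mem_erase, Finset.mem_univ, and_true] at hcon hω
      obtain ⟨⟨h1, h2⟩, h3⟩ := hcon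
      have hclose : |(n : ℝ) * Y n ω - n * ermEst β n (fun t => x istar t ω)| ≤
          C * ∑ i ∈ Finset.univ.erase istar, (pulls a i n ω : ℝ) :=
        abs_stream_sub_ermEst_le a istar hn ω hβ (fun i t => x i t ω)
          fun i t => hxbdd i t ω
      have hw0 : 0 < 4 * ((n : ℝ) ^ e * z / M) := by positivity
      have hW : ∑ i ∈ Finset.univ.erase istar, (pulls a i n ω : ℝ)
          ≤ K * (4 * ((n : ℝ) ^ e * z / M)) := by
        calc _ ≤ ∑ i ∈ Finset.univ.erase istar, 4 * ((n : ℝ) ^ e * z / M) :=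
              Finset.sum_le_sum fun i hi => (h3 i (Finset.ne_of_mem_erase hi)).le
          _ ≤ ∑ i : Fin K, 4 * ((n : ℝ) ^ e * z / M) :=
              Finset.sum_le_sum_of_subset_of_nonneg (Finset.subset_univ _) fun _ _ _ => hw0.le
          _ = _ := by simp
      have hCW : C * ∑ i ∈ Finset.univ.erase istar, (pulls a i n ω : ℝ)
          ≤ (n : ℝ) ^ e * z / 2 := by
        calc _ ≤ C * (K * (4 * ((n : ℝ) ^ e * z / M))) := by gcongr
          _ = _ := by rw [hMdef]; field_simp; norm_num
      have h4 : |(n : ℝ) * ermEst β n (fun t => x istar t ω) - n * μ istar|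
          < (n : ℝ) ^ η * (z / 2) := abs_lt.2 ⟨h2, h1⟩
      have h5 : (n : ℝ) ^ η * (z / 2) ≤ (n : ℝ) ^ e * (z / 2) := by gcongr
      have h6 := abs_sub_le ((n : ℝ) * Y n ω) (n * ermEst β n (fun t => x istar t ω))
        (n * μ istar)
      linarith
    have hθz : θ / (z / 2) ^ ξ ≤ θ * 2 ^ ξ / z ^ (α - 1) := by
      rw [Real.div_rpow (by linarith) (by norm_num), div_div_eq_mul_div]
      gcongr
    calc _ ≤ _ := measure_mono hsub
      _ ≤ _ := (measure_union_le _ _).trans (add_le_add_left (measure_union_le _ _) _)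
      _ ≤ (ENNReal.ofReal (θ * 2 ^ ξ / z ^ (α - 1)) + ENNReal.ofReal (θ * 2 ^ ξ / z ^ (α - 1)))
          + ENNReal.ofReal (K * (2 * M ^ (α - 1) / z ^ (α - 1))) := by
        gcongr
        · exact (hconcU istar n hn _ hz2).trans (ENNReal.ofReal_le_ofReal hθz)
        · exact (hconcL istar n hn _ hz2).trans (ENNReal.ofReal_le_ofReal hθz)
        · calc _ ≤ _ := measure_biUnion_finset_le _ _
            _ ≤ ∑ i ∈ Finset.univ.erase istar,
                ENNReal.ofReal (2 * M ^ (α - 1) / z ^ (α - 1)) := by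
              refine Finset.sum_le_sum fun i hi => ?_
              have hi' := Finset.ne_of_mem_erase hi
              refine measure_scaled_le_pulls_le P a i hn he0.le hα2 hD0 hM0 (by linarith)
                fun u hu hDu => ?_
              exact measure_lt_pulls_le P hθ hξ hα2 (fun i s ω => ermEst β s fun t => x i t ω)
                μ hi' (hconcU istar) (hconcL i) a hinit hsel hu
                ((two_mul_bonus_le hθ hξ hη1 hΔ0 hu hDu).trans (hΔ.2 ⟨i, hi', rfl⟩))
            _ ≤ ∑ i : Fin K, ENNReal.ofReal (2 * M ^ (α - 1) / z ^ (α - 1)) :=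
              Finset.sum_le_sum_of_subset (Finset.subset_univ _)
            _ = _ := by
              rw [ENNReal.ofReal_mul hK0.le]
              simp
      _ = ENNReal.ofReal ((2 * θ * 2 ^ ξ + K * (2 * M ^ (α - 1))) / z ^ (α - 1)) := by
        rw [← ENNReal.ofReal_add (by positivity) (by positivity),
          ← ENNReal.ofReal_add (by positivity) (by positivity)]
        congr 1
        ring
      _ ≤ _ := by
        apply ENNReal.ofReal_le_ofReal
        gcongr
        rw [hθ']
        linarith
  have hmean : ∀ n : ℕ, 1 ≤ n →
      |∫ ω, Y n ω ∂P - μ istar| ≤ (1 + 2 * θ' / (α - 2)) * (n : ℝ) ^ (e - 1) := by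
    intro n hn
    refine (abs_integral_sub_le_of_tail P (hY n) hn (by linarith) (by linarith)
      (htail n hn)).trans ?_
    rw [show α - 1 - 1 = α - 2 by ring]
    have : 0 < α - 2 := by linarith
    gcongr
    linarith
  refine ⟨θ', hθ'1, fun n hn z hz => ⟨?_, ?_⟩, hmean, ?_⟩
  · refine (measure_mono fun ω hω => ?_).trans (htail n hn z hz)
    simp only [Set.mem_ofPred_eq] at hω ⊢
    exact le_trans hω (le_abs_self _)
  · refine (measure_mono fun ω hω => ?_).trans (htail n hn z hz)
    simp only [Set.mem_ofPred_eq] at hω ⊢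
    exact le_trans (by linarith) (neg_le_abs _)
  · rw [tendsto_iff_norm_sub_tendsto_zero]
    have hlim : Tendsto (fun n : ℕ => (1 + 2 * θ' / (α - 2)) * (n : ℝ) ^ (e - 1)) atTop
        (nhds 0) := by
      have := ((tendsto_rpow_neg_atTop (by linarith : 0 < 1 - e)).comp
        tendsto_natCast_atTop_atTop).const_mul (1 + 2 * θ' / (α - 2))
      simpa [Function.comp_def] using this
    refine squeeze_zero' (Eventually.of_forall fun n => norm_nonneg _) ?_ hlim
    filter_upwards [eventually_ge_atTop 1] with n hn
    exact hmean n hn
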